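/- arXiv:2310.17859 — 2 statements merged into one kernel-verified Lean document; each statement's English description precedes it below -/
import Mathlib

section
/- Let a, b, c, n be positive integers with a ≥ b and n ≥ a + c, and let C be a c-element subset of [n]. Suppose A is the a-partner of C and B is the b-partner of C. Then B ≺ A or A is the a-parity of B. -/
open Finset

attribute [local instance] Classical.propDecidable

noncomputable section

/-- The ground set `[n] = {1, …, n}`. -/
def ground (n : ℕ) : Finset ℕ := Finset.Icc 1 n

/-- `C([n], k)`: the family of all `k`-element subsets of `[n]`. -/
def ksubsets (n k : ℕ) : Finset (Finset ℕ) := Finset.powersetCard k (ground n)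

/-- Two families are cross intersecting. -/
def CrossInt (A B : Finset (Finset ℕ)) : Prop :=
  ∀ a ∈ A, ∀ b ∈ B, (a ∩ b).Nonempty

/-- The lexicographic order `A ≺ B`:  `A ⊇ B` or `min (A ∖ B) < min (B ∖ A)`. -/
def lex (A B : Finset ℕ) : Prop :=
  B ⊆ A ∨ (A \ B).min < (B \ A).min

/-- Strict lexicographic order `A ⪵ B`. -/
def lexLT (A B : Finset ℕ) : Prop := lex A B ∧ A ≠ B

/-- `L(R, k)` over `[n]`: all `k`-subsets of `[n]` that are `≺ R`. -/
def Lset (n : ℕ) (R : Finset ℕ) (k : ℕ) : Finset (Finset ℕ) :=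
  (ksubsets n k).filter fun F => lex F R

/-- `L(r, k)`: the first `r` elements of `C([n], k)` in lexicographic order. -/
def Lnum (n r k : ℕ) : Finset (Finset ℕ) :=
  (ksubsets n k).filter fun F => ((ksubsets n k).filter fun G => lex G F).card ≤ r

/-- A family is L-initial if it equals `L(R, k)` for some `k`-set `R` (an ID of the family). -/
def LInitial (n k : ℕ) (A : Finset (Finset ℕ)) : Prop :=
  ∃ R ∈ ksubsets n k, A = Lset n R k

/-- `F` and `H` strongly intersect at their last element; `H` is the partner of `F`
(and `F` is the partner of `H`). -/
def IsPartner (F H : Finset ℕ) : Prop :=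
  ∃ q, F ∩ H = {q} ∧ F ∪ H = Finset.Icc 1 q

/-- `K` is the `k`-partner of `F` (inside `[n]`). -/
def IsKPartner (n k : ℕ) (F K : Finset ℕ) : Prop :=
  ∃ H, IsPartner F H ∧
    ((k = H.card ∧ K = H) ∨
     (H.card < k ∧ K = H ∪ Finset.Icc (n - k + H.card + 1) n) ∨
     (k < H.card ∧ K ∈ ksubsets n k ∧ lex K H ∧
        ∀ K' ∈ ksubsets n k, lex K' H → lex K' K))

/-- `ℓ(F)`: the largest `x` with `{n - x + 1, …, n} ⊆ F` (and `0` if there is none). -/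
def ell (n : ℕ) (F : Finset ℕ) : ℕ :=
  ((Finset.range (n + 1)).filter fun x => Finset.Icc (n - x + 1) n ⊆ F).sup id

/-- `F^t = {n - ℓ(F) + 1, …, n}` (which is `∅` when `ℓ(F) = 0`). -/
def tailPart (n : ℕ) (F : Finset ℕ) : Finset ℕ := Finset.Icc (n - ell n F + 1) n

/-- Maximal cross intersecting families. -/
def MaximalCross (n f g : ℕ) (F G : Finset (Finset ℕ)) : Prop :=
  F ⊆ ksubsets n f ∧ G ⊆ ksubsets n g ∧ CrossInt F G ∧
    ∀ F' G' : Finset (Finset ℕ), F ⊆ F' → F' ⊆ ksubsets n f →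
      G ⊆ G' → G' ⊆ ksubsets n g → CrossInt F' G' → F = F' ∧ G = G'

/-- The pair of sets `(F, G)` is maximal. -/
def PairMaximal (n : ℕ) (F G : Finset ℕ) : Prop :=
  MaximalCross n F.card G.card (Lset n F F.card) (Lset n G G.card)

/-- Maximal pair families. -/
def MaximalPairFamilies (n : ℕ) (A1 A2 : Finset (Finset ℕ)) : Prop :=
  A1.card = A2.card ∧ ∀ a1 ∈ A1, ∃! a2, a2 ∈ A2 ∧ PairMaximal n a1 a2

/-- `H1` is the `|H1|`-parity of `H2` (intended for `|H1| ≤ |H2|`):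
`H1 ∖ H1^t = H2 ∖ H2^t` and `ℓ(H2) - ℓ(H1) = |H2| - |H1|`. -/
def IsParity (n : ℕ) (H1 H2 : Finset ℕ) : Prop :=
  H1 \ tailPart n H1 = H2 \ tailPart n H2 ∧
    ell n H2 + H1.card = ell n H1 + H2.card

/-- The family `H1` of `h1`-sets is the `h1`-parity of the family `H2` of `h2`-sets. -/
def FamParity (n h1 h2 : ℕ) (H1 H2 : Finset (Finset ℕ)) : Prop :=
  (∀ A ∈ H1, ∃ B ∈ ksubsets n h2, IsParity n A B ∧ B ∈ H2) ∧
  (∀ B ∈ H2, ∀ A ∈ ksubsets n h1, IsParity n A B → A ∈ H1)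

/-- An `(n, k 0, …, k (t-1))`-cross intersecting system:  non-empty pairwise
cross intersecting families `F i ⊆ C([n], k i)`. -/
def IsCIS (n : ℕ) {t : ℕ} (k : Fin t → ℕ) (F : Fin t → Finset (Finset ℕ)) : Prop :=
  (∀ i, F i ⊆ ksubsets n (k i)) ∧ (∀ i, (F i).Nonempty) ∧
    ∀ i j : Fin t, i < j → CrossInt (F i) (F j)

/-- An extremal cross intersecting system. -/
def Extremal (n : ℕ) {t : ℕ} (k : Fin t → ℕ) (F : Fin t → Finset (Finset ℕ)) : Prop :=
  IsCIS n k F ∧ ∀ G : Fin t → Finset (Finset ℕ), IsCIS n k G →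
    ∑ i, (G i).card ≤ ∑ i, (F i).card

/-- Two systems of families are isomorphic via a permutation of the ground set `[n]`. -/
def IsoSystems (n : ℕ) {t : ℕ} (F G : Fin t → Finset (Finset ℕ)) : Prop :=
  ∃ σ : Equiv.Perm ℕ, (∀ x ∈ ground n, σ x ∈ ground n) ∧
    ∀ i, F i = (G i).image fun s => s.image ⇑σ

/-- The family `ℛ₂`. -/
def R2fam (n k2 kt : ℕ) : Finset (Finset ℕ) :=
  (ksubsets n k2).filter fun R =>
    lex (insert 1 (Finset.Icc (n - k2 + 2) n)) R ∧
    lex R (insert kt (Finset.Icc (n - k2 + 2) n))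

/-- The family `ℱ₂,₃`. -/
def F23 (n k2 k3 kt : ℕ) : Finset (Finset ℕ) :=
  (R2fam n k2 kt).filter fun A => ∃ B ∈ ksubsets n k3, PairMaximal n A B

theorem lex_iff {A B : Finset ℕ} :
    lex A B ↔ B ⊆ A ∨ ∃ m ∈ A, m ∉ B ∧ ∀ x < m, x ∈ A ↔ x ∈ B := by
  refine or_congr_right' fun hBA => ⟨fun h => ?_, ?_⟩
  · have hne : (A \ B).Nonempty := by
      by_contra h0
      rw [Finset.not_nonempty_iff_eq_empty] at h0
      simp [h0] at h
    obtain ⟨m, hm⟩ := Finset.min_of_nonempty hne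
    have hmem := Finset.mem_of_min hm
    rw [Finset.mem_sdiff] at hmem
    refine ⟨m, hmem.1, hmem.2, fun x hx => ⟨fun hxA => ?_, fun hxB => ?_⟩⟩
    · by_contra hxB
      have := Finset.min_le_of_eq (Finset.mem_sdiff.2 ⟨hxA, hxB⟩) hm
      omega
    · by_contra hxA
      have h1 := Finset.min_le (Finset.mem_sdiff.2 ⟨hxB, hxA⟩)
      rw [hm] at h
      have h2 := WithTop.coe_lt_coe.1 (lt_of_lt_of_le h h1)
      omega
  · rintro ⟨m, hmA, hmB, hx⟩
    refine lt_of_le_of_lt (Finset.min_le (Finset.mem_sdiff.2 ⟨hmA, hmB⟩)) ?_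
    obtain ⟨y, hyB, hyA⟩ := Finset.not_subset.1 hBA
    obtain ⟨z, hz⟩ := Finset.min_of_nonempty ⟨y, Finset.mem_sdiff.2 ⟨hyB, hyA⟩⟩
    rw [hz]
    have hzm := Finset.mem_sdiff.1 (Finset.mem_of_min hz)
    refine WithTop.coe_lt_coe.2 ?_
    by_contra hlt
    rcases (not_lt.1 hlt).lt_or_eq with h | h
    · exact hzm.2 ((hx z h).2 hzm.1)
    · exact hmB (h ▸ hzm.1)

theorem ell_union_Icc {n s x : ℕ} {P : Finset ℕ} (hP : ∀ y ∈ P, y ≤ s) (hs : s + x < n) :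
    ell n (P ∪ Finset.Icc (n - x + 1) n) = x := by
  apply le_antisymm
  · refine Finset.sup_le fun y hy => ?_
    rw [Finset.mem_filter, Finset.mem_range] at hy
    by_contra hlt
    simp only [id, not_le] at hlt
    have hmem := hy.2 (Finset.mem_Icc.2 (⟨by omega, by omega⟩ : n - y + 1 ≤ n - x ∧ n - x ≤ n))
    rw [Finset.mem_union, Finset.mem_Icc] at hmem
    rcases hmem with h | h
    · have := hP _ h
      omega
    · omega
  · refine Finset.le_sup (f := id) (Finset.mem_filter.2 ⟨?_, Finset.subset_union_right⟩)
    rw [Finset.mem_range]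
    omega

theorem disjoint_Icc_of_bound {n s x : ℕ} {P : Finset ℕ} (hP : ∀ y ∈ P, y ≤ s)
    (hs : s + x < n) : Disjoint P (Finset.Icc (n - x + 1) n) := by
  rw [Finset.disjoint_left]
  intro y hy hy'
  have := hP y hy
  rw [Finset.mem_Icc] at hy'
  omega

theorem card_union_Icc {n s x : ℕ} {P : Finset ℕ} (hP : ∀ y ∈ P, y ≤ s) (hs : s + x < n) :
    (P ∪ Finset.Icc (n - x + 1) n).card = P.card + x := by
  rw [Finset.card_union_of_disjoint (disjoint_Icc_of_bound hP hs), Nat.card_Icc]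
  omega

theorem isParity_union_Icc {n s x y : ℕ} {P : Finset ℕ} (hP : ∀ z ∈ P, z ≤ s)
    (hx : s + x < n) (hy : s + y < n) :
    IsParity n (P ∪ Finset.Icc (n - y + 1) n) (P ∪ Finset.Icc (n - x + 1) n) := by
  unfold IsParity tailPart
  rw [ell_union_Icc hP hx, ell_union_Icc hP hy, card_union_Icc hP hx, card_union_Icc hP hy,
    Finset.union_sdiff_cancel_right (disjoint_Icc_of_bound hP hx),
    Finset.union_sdiff_cancel_right (disjoint_Icc_of_bound hP hy)]
  exact ⟨rfl, by omega⟩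

theorem IsPartner.unique {F H H' : Finset ℕ} (h : IsPartner F H) (h' : IsPartner F H') :
    H = H' := by
  obtain ⟨q, h1, h2⟩ := h
  obtain ⟨q', h1', h2'⟩ := h'
  simp only [Finset.ext_iff, Finset.mem_inter, Finset.mem_union, Finset.mem_singleton,
    Finset.mem_Icc] at h1 h2 h1' h2'
  have e1 := (h1 q).2 rfl
  have e2 := (h1' q').2 rfl
  have e3 := (h2 q').1 (Or.inl e2.1)
  have e4 := (h2' q).1 (Or.inl e1.1)
  obtain rfl : q = q' := by omega
  ext x
  have := h1 x
  have := h2 x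
  have := h1' x
  have := h2' x
  tauto

/-- The initial segment of a set first differing from `H` at `m ∉ H`. -/
def branch (H : Finset ℕ) (m : ℕ) : Finset ℕ := insert m (H.filter (· < m))

theorem mem_branch {H : Finset ℕ} {m x : ℕ} : x ∈ branch H m ↔ x = m ∨ x ∈ H ∧ x < m := by
  simp [branch]

theorem le_of_mem_branch {H : Finset ℕ} {m x : ℕ} (hx : x ∈ branch H m) : x ≤ m := by
  rcases mem_branch.1 hx with h | h <;> omega

theorem branch_subset {H K : Finset ℕ} {m : ℕ} (hm : m ∈ K)
    (hx : ∀ x < m, x ∈ K ↔ x ∈ H) : branch H m ⊆ K := by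
  intro x h
  rcases mem_branch.1 h with rfl | h
  · exact hm
  · exact (hx x h.2).2 h.1

/-- Since `H` has more than `k` elements, there is room for the tail of a `k`-set. -/
theorem branch_room {n k m : ℕ} {H : Finset ℕ} (hH : H ⊆ ground n) (hk : k < H.card)
    (hm : m ∉ H) (hp : (branch H m).card ≤ k) : m + (k - (branch H m).card) < n := by
  have h1 : (branch H m).card = (H.filter (· < m)).card + 1 := by
    unfold branch
    rw [Finset.card_insert_of_notMem (by simp)]
  have h2 : H ⊆ H.filter (· < m) ∪ Finset.Icc (m + 1) n := by
    intro x hx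
    have h3 := Finset.mem_Icc.1 (hH hx)
    have h4 : x ≠ m := fun h => hm (h ▸ hx)
    rw [Finset.mem_union, Finset.mem_filter, Finset.mem_Icc]
    by_cases h5 : x < m
    · exact Or.inl ⟨hx, h5⟩
    · exact Or.inr (by omega)
  have h3 := (Finset.card_le_card h2).trans (Finset.card_union_le _ _)
  rw [Nat.card_Icc] at h3
  omega

/-- The last `k`-set extending `branch H m`. -/
def branchSet (n k : ℕ) (H : Finset ℕ) (m : ℕ) : Finset ℕ :=
  branch H m ∪ Finset.Icc (n - (k - (branch H m).card) + 1) n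

theorem mem_branchSet_iff_of_lt {n k m x : ℕ} {H : Finset ℕ}
    (hroom : m + (k - (branch H m).card) < n) (hx : x < m) :
    x ∈ branchSet n k H m ↔ x ∈ H := by
  rw [branchSet, Finset.mem_union, Finset.mem_Icc, mem_branch]
  constructor
  · rintro ((h | h) | h)
    · omega
    · exact h.1
    · omega
  · exact fun h => Or.inl (Or.inr ⟨h, hx⟩)

theorem branchSet_mem {n k m : ℕ} {H : Finset ℕ} (hH : H ⊆ ground n) (hm0 : 0 < m)
    (hp : (branch H m).card ≤ k) (hroom : m + (k - (branch H m).card) < n) :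
    branchSet n k H m ∈ ksubsets n k := by
  rw [ksubsets, Finset.mem_powersetCard]
  constructor
  · intro x hx
    rw [branchSet, Finset.mem_union, Finset.mem_Icc, mem_branch] at hx
    rcases hx with (h | h) | h
    · exact Finset.mem_Icc.2 (by omega)
    · exact hH h.1
    · exact Finset.mem_Icc.2 (by omega)
  · rw [branchSet, card_union_Icc (fun _ => le_of_mem_branch) hroom]
    omega

theorem lex_branchSet {n k m : ℕ} {H : Finset ℕ} (hm : m ∉ H)
    (hroom : m + (k - (branch H m).card) < n) : lex (branchSet n k H m) H :=
  lex_iff.2 <| Or.inr ⟨m, Finset.mem_union_left _ (mem_branch.2 (Or.inl rfl)), hm,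
    fun _ hx => mem_branchSet_iff_of_lt hroom hx⟩

/-- A set with fewer elements than `H` preceding it differs from `H` at a first element. -/
theorem exists_first_diff {K H : Finset ℕ} (hcard : K.card < H.card) (h : lex K H) :
    ∃ m ∈ K, m ∉ H ∧ ∀ x < m, x ∈ K ↔ x ∈ H := by
  rcases lex_iff.1 h with h | h
  · have := Finset.card_le_card h
    omega
  · exact h

theorem first_diff_le {n k m m' : ℕ} {K H : Finset ℕ} (hH : H ⊆ ground n) (hk : k < H.card)
    (hmax : ∀ K' ∈ ksubsets n k, lex K' H → lex K' K)
    (hm : m ∈ K) (hmH : m ∉ H) (hx : ∀ x < m, x ∈ K ↔ x ∈ H)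
    (hm0' : 0 < m') (hmH' : m' ∉ H) (hp : (branch H m').card ≤ k) : m' ≤ m := by
  by_contra! hlt
  have hroom := branch_room hH hk hmH' hp
  have hl := hmax _ (branchSet_mem hH hm0' hp hroom) (lex_branchSet hmH' hroom)
  have hmK : m ∉ branchSet n k H m' := fun h =>
    hmH ((mem_branchSet_iff_of_lt hroom hlt).1 h)
  rcases lex_iff.1 hl with h | ⟨z, hz, hzK, hagree⟩
  · exact hmK (h hm)
  · rcases lt_trichotomy z m with h | h | h
    · exact hzK ((hx z h).2 ((mem_branchSet_iff_of_lt hroom (h.trans hlt)).1 hz))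
    · exact hzK (h ▸ hm)
    · exact hmK ((hagree m h).2 hm)

theorem eq_branchSet {n k m : ℕ} {K H : Finset ℕ} (hH : H ⊆ ground n) (hk : k < H.card)
    (hK : K ∈ ksubsets n k) (hmax : ∀ K' ∈ ksubsets n k, lex K' H → lex K' K)
    (hm : m ∈ K) (hmH : m ∉ H) (hx : ∀ x < m, x ∈ K ↔ x ∈ H) :
    (branch H m).card ≤ k ∧ K = branchSet n k H m := by
  obtain ⟨hKn, hKc⟩ := Finset.mem_powersetCard.1 hK
  have hbK := branch_subset hm hx
  have hp : (branch H m).card ≤ k := hKc ▸ Finset.card_le_card hbK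
  refine ⟨hp, ?_⟩
  have hroom := branch_room hH hk hmH hp
  have hm0 : 0 < m := (Finset.mem_Icc.1 (hKn hm)).1
  have hmem := branchSet_mem hH hm0 hp hroom
  have hcard := (Finset.mem_powersetCard.1 hmem).2
  rcases lex_iff.1 (hmax _ hmem (lex_branchSet hmH hroom)) with h | ⟨z, hz, hzK, hagree⟩
  · exact Finset.eq_of_subset_of_card_le h (by omega)
  · refine Finset.eq_of_subset_of_card_le (fun y hy => ?_) (by omega)
    have hyn := Finset.mem_Icc.1 (hKn hy)
    by_cases hyz : y < z
    · exact (hagree y hyz).2 hy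
    · rw [branchSet, Finset.mem_union, Finset.mem_Icc] at hz ⊢
      rcases hz with hz | hz
      · exact absurd (hbK hz) hzK
      · exact Or.inr (by omega)

theorem lex_or_isParity_of_card_lt {n a b : ℕ} {A B H : Finset ℕ} (hba : b ≤ a)
    (hH : H ⊆ ground n) (hah : a < H.card)
    (hA : A ∈ ksubsets n a) (hAH : lex A H)
    (hAmax : ∀ K' ∈ ksubsets n a, lex K' H → lex K' A)
    (hB : B ∈ ksubsets n b) (hBH : lex B H)
    (hBmax : ∀ K' ∈ ksubsets n b, lex K' H → lex K' B) :
    lex B A ∨ IsParity n B A := by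
  obtain ⟨hAn, hAc⟩ := Finset.mem_powersetCard.1 hA
  obtain ⟨hBn, hBc⟩ := Finset.mem_powersetCard.1 hB
  have hbh : b < H.card := by omega
  obtain ⟨m, hm, hmH, hx⟩ := exists_first_diff (hAc ▸ hah) hAH
  obtain ⟨m', hm', hmH', hx'⟩ := exists_first_diff (hBc ▸ hbh) hBH
  obtain ⟨hpA, hAeq⟩ := eq_branchSet hH hah hA hAmax hm hmH hx
  obtain ⟨hpB, hBeq⟩ := eq_branchSet hH hbh hB hBmax hm' hmH' hx'
  have hle := first_diff_le hH hah hAmax hm hmH hx (Finset.mem_Icc.1 (hBn hm')).1 hmH'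
    (hpB.trans hba)
  rcases hle.lt_or_eq with h | rfl
  · refine Or.inl (lex_iff.2 (Or.inr ⟨m', hm', fun h' => hmH' ((hx m' h).1 h'), fun x hlt => ?_⟩))
    rw [hx' x hlt, hx x (hlt.trans h)]
  · right
    rw [hAeq, hBeq]
    exact isParity_union_Icc (fun _ => le_of_mem_branch) (branch_room hH hah hmH hpA)
      (branch_room hH hbh hmH hpB)

theorem IsPartner.card_add_card {F H : Finset ℕ} {q : ℕ} (h1 : F ∩ H = {q})
    (h2 : F ∪ H = Finset.Icc 1 q) : F.card + H.card = q + 1 := by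
  rw [← Finset.card_union_add_card_inter, h1, h2, Nat.card_Icc, Finset.card_singleton]
  omega

/-- For `k` at least the size of the partner `H`, the `k`-partner is `H` plus a tail. -/
theorem eq_union_Icc_of_card_le {n k : ℕ} {H K : Finset ℕ} (hkn : k ≤ n)
    (hK : (k = H.card ∧ K = H) ∨
      (H.card < k ∧ K = H ∪ Finset.Icc (n - k + H.card + 1) n)) :
    H.card ≤ k ∧ K = H ∪ Finset.Icc (n - (k - H.card) + 1) n := by
  rcases hK with ⟨h, rfl⟩ | ⟨h, rfl⟩
  · simp [h]
  · refine ⟨h.le, ?_⟩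
    congr 3
    omega

/-- if `A` is the `a`-partner and `B` the `b`-partner of `C` with `a ≥ b`,
then `B ≺ A` or `A` is the `a`-parity of `B`. -/
theorem kpartners_lex_or_parity (a b c n : ℕ) (ha : 0 < a) (hb : 0 < b) (hc : 0 < c)
    (hba : b ≤ a) (hn : a + c ≤ n)
    (C A B : Finset ℕ) (hC : C ∈ ksubsets n c)
    (hA : IsKPartner n a C A) (hB : IsKPartner n b C B) :
    lex B A ∨ IsParity n B A := by
  obtain ⟨H, hCH, hA⟩ := hA
  obtain ⟨H', hCH', hB⟩ := hB
  obtain rfl := hCH.unique hCH'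
  obtain ⟨q, h1, h2⟩ := hCH
  obtain ⟨hCn, hCc⟩ := Finset.mem_powersetCard.1 hC
  have hcard := IsPartner.card_add_card h1 h2
  have hqC : q ∈ C ∩ H := by simp [h1]
  have hqn := (Finset.mem_Icc.1 (hCn (Finset.mem_inter.1 hqC).1)).2
  have hHq : ∀ x ∈ H, 1 ≤ x ∧ x ≤ q := fun x hx =>
    Finset.mem_Icc.1 (h2 ▸ Finset.mem_union_right C hx)
  have hH : H ⊆ ground n := fun x hx =>
    Finset.mem_Icc.2 ⟨(hHq x hx).1, (hHq x hx).2.trans hqn⟩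
  rw [← or_assoc] at hA hB
  rcases hA with hA | ⟨hah, hAk, hAH, hAmax⟩
  · obtain ⟨hha, hAeq⟩ := eq_union_Icc_of_card_le (by omega) hA
    rcases hB with hB | ⟨hbh, hBk, hBH, -⟩
    · obtain ⟨hhb, hBeq⟩ := eq_union_Icc_of_card_le (by omega) hB
      right
      rw [hAeq, hBeq]
      exact isParity_union_Icc (fun x hx => (hHq x hx).2) (by omega) (by omega)
    · left
      have hBc := (Finset.mem_powersetCard.1 hBk).2
      obtain ⟨m, hm, hmH, hx⟩ := exists_first_diff (hBc ▸ hbh) hBH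
      have hmq : m < q := by
        by_contra! hqm
        have hsub : H ⊆ B := fun x hxH => by
          have h3 := (hHq x hxH).2
          have h4 : x ≠ m := fun h => hmH (h ▸ hxH)
          exact (hx x (by omega)).2 hxH
        have := Finset.card_le_card hsub
        omega
      have hAH : ∀ x ≤ q, x ∈ A ↔ x ∈ H := fun x hxq => by
        rw [hAeq, Finset.mem_union, Finset.mem_Icc, or_iff_left (by omega)]
      exact lex_iff.2 (Or.inr ⟨m, hm, fun h => hmH ((hAH m hmq.le).1 h), fun x hlt => by
        rw [hx x hlt, hAH x (by omega)]⟩)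
  · rcases hB with hB | ⟨-, hBk, hBH, hBmax⟩
    · obtain ⟨hhb, -⟩ := eq_union_Icc_of_card_le (by omega) hB
      omega
    · exact lex_or_isParity_of_card_lt hba hH hah hAk hAH hAmax hBk hBH hBmax
end
end

section
/- Let t ≥ 3, k1 > k2 ≥ ... ≥ kt ≥ 2 and k1 + k3 ≤ n < k1 + k2, and let (ℱ1,...,ℱt) be an extremal (n,k1,...,kt)-cross intersecting system in which every ℱi is L-initial with ID Ii. If I1 = {1, n−k1+2, ..., n} or I1 = {kt, n−k1+2, ..., n}, or I2 = {1, n−k2+2, ..., n} or I2 = {kt, n−k2+2, ..., n}, then Σ_{i=1}^t |ℱi| = max{λ1, λ2}. -/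
open Finset

attribute [local instance] Classical.propDecidable

noncomputable section

/-- In a ground set `V`, cross intersecting families of `p`-sets and `q`-sets with
`p + q ≤ |V|` have densities summing to at most one. -/
theorem crossInt_density_le_one {V : Finset ℕ} {p q : ℕ} (hpq : p + q ≤ V.card)
    {A B : Finset (Finset ℕ)} (hA : A ⊆ powersetCard p V) (hB : B ⊆ powersetCard q V)
    (hAB : CrossInt A B) :
    (A.card : ℚ) / (V.card.choose p) + (B.card : ℚ) / (V.card.choose q) ≤ 1 := by
  have hcount : ∀ (p q : ℕ) (S : Finset ℕ), S ∈ powersetCard p V →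
      ((powersetCard q V).filter fun T => Disjoint S T).card = (V.card - p).choose q := by
    intro p q S hS
    rw [mem_powersetCard] at hS
    have : ((powersetCard q V).filter fun T => Disjoint S T) = powersetCard q (V \ S) := by
      ext T
      simp only [mem_filter, mem_powersetCard, subset_sdiff, disjoint_comm (a := S)]
      tauto
    rw [this, card_powersetCard, card_sdiff_of_subset hS.1, hS.2]
  set P := (powersetCard p V ×ˢ powersetCard q V).filter fun x => Disjoint x.1 x.2 with hP
  have hfst : ∀ A ⊆ powersetCard p V,
      (P.filter fun x => x.1 ∈ A).card = A.card * (V.card - p).choose q := by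
    intro A hA
    rw [card_eq_sum_card_fiberwise (f := Prod.fst) (t := A), sum_const_nat]
    · intro S hS
      rw [← hcount p q S (hA hS)]
      refine card_bij (fun x _ => x.2) ?_ ?_ ?_
      · rintro ⟨a, b⟩ h
        simp only [hP, mem_filter, mem_product] at h ⊢
        obtain ⟨⟨⟨⟨-, hb⟩, hd⟩, -⟩, rfl⟩ := h
        exact ⟨hb, hd⟩
      · rintro ⟨a, b⟩ h ⟨a', b'⟩ h' e
        simp only [mem_filter] at h h' e
        rw [h.2, h'.2, e]
      · intro b hb
        simp only [mem_filter] at hb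
        exact ⟨(S, b), by simp [hP, hb, hA hS, hS], rfl⟩
    · intro x hx
      simpa using (mem_filter.1 hx).2
  have hsnd : ∀ B ⊆ powersetCard q V,
      (P.filter fun x => x.2 ∈ B).card = B.card * (V.card - q).choose p := by
    intro B hB
    rw [card_eq_sum_card_fiberwise (f := Prod.snd) (t := B), sum_const_nat]
    · intro S hS
      rw [← hcount q p S (hB hS)]
      refine card_bij (fun x _ => x.1) ?_ ?_ ?_
      · rintro ⟨a, b⟩ h
        simp only [hP, mem_filter, mem_product] at h ⊢
        obtain ⟨⟨⟨⟨ha, -⟩, hd⟩, -⟩, rfl⟩ := h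
        exact ⟨ha, hd.symm⟩
      · rintro ⟨a, b⟩ h ⟨a', b'⟩ h' e
        simp only [mem_filter] at h h' e
        rw [h.2, h'.2, e]
      · intro b hb
        simp only [mem_filter] at hb
        exact ⟨(b, S), by simp [hP, hb.2.symm, hS, mem_powersetCard.1 (hB hS),
          mem_powersetCard.1 hb.1], rfl⟩
    · intro x hx
      simpa using (mem_filter.1 hx).2
  have htot1 : P.card = V.card.choose p * (V.card - p).choose q := by
    rw [← card_powersetCard p V, ← hfst _ Subset.rfl]
    congr 1
    refine (filter_true_of_mem fun x hx => ?_).symm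
    exact (mem_product.1 (mem_filter.1 hx).1).1
  have htot2 : P.card = V.card.choose q * (V.card - q).choose p := by
    rw [← card_powersetCard q V, ← hsnd _ Subset.rfl]
    congr 1
    refine (filter_true_of_mem fun x hx => ?_).symm
    exact (mem_product.1 (mem_filter.1 hx).1).2
  have hle : A.card * (V.card - p).choose q + B.card * (V.card - q).choose p ≤ P.card := by
    rw [← hfst A hA, ← hsnd B hB, ← card_union_of_disjoint]
    · exact card_le_card (union_subset (filter_subset _ _) (filter_subset _ _))
    · rw [disjoint_left]
      intro x hx hx'
      have h1 := hAB _ (mem_filter.1 hx).2 _ (mem_filter.1 hx').2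
      have h2 := (mem_filter.1 (mem_filter.1 hx).1).2
      rw [disjoint_iff_inter_eq_empty] at h2
      exact h1.ne_empty h2
  have c1 : (0 : ℚ) < V.card.choose p := by exact_mod_cast Nat.choose_pos (by omega)
  have c2 : (0 : ℚ) < V.card.choose q := by exact_mod_cast Nat.choose_pos (by omega)
  have c3 : (0 : ℚ) < (V.card - p).choose q := by exact_mod_cast Nat.choose_pos (by omega)
  have c4 : (0 : ℚ) < (V.card - q).choose p := by exact_mod_cast Nat.choose_pos (by omega)
  have hPpos : (0 : ℚ) < P.card := by rw [htot1]; push_cast; positivity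
  have e1 : (A.card : ℚ) / V.card.choose p = A.card * (V.card - p).choose q / P.card := by
    rw [htot1]; push_cast; field_simp
  have e2 : (B.card : ℚ) / V.card.choose q = B.card * (V.card - q).choose p / P.card := by
    rw [htot2]; push_cast; field_simp
  rw [e1, e2, ← add_div, div_le_one hPpos]
  exact_mod_cast hle

theorem lex_of_forall_lt {F R : Finset ℕ} {y : ℕ} (hy : y ∈ F \ R)
    (h : ∀ z ∈ R \ F, y < z) : lex F R := by
  refine Or.inr ((min_le hy).trans_lt ?_)
  rw [Finset.min, Finset.lt_inf_iff (WithTop.coe_lt_top y)]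
  exact fun z hz => WithTop.coe_lt_coe.2 (h z hz)

theorem lex_of_lt_forall {F R : Finset ℕ} {x : ℕ} (hx : x ∈ F) (h : ∀ z ∈ R, x < z) :
    lex F R :=
  lex_of_forall_lt (mem_sdiff.2 ⟨hx, fun hxR => (h x hxR).false⟩)
    fun z hz => h z (mem_sdiff.1 hz).1

theorem exists_le_of_lex {F R : Finset ℕ} {r : ℕ} (h : lex F R) (hr : r ∈ R) :
    ∃ x ∈ F, x ≤ r := by
  by_cases hrF : r ∈ F
  · exact ⟨r, hrF, le_rfl⟩
  rcases h with h | h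
  · exact ⟨r, h hr, le_rfl⟩
  have h1 : (F \ R).min < (r : WithTop ℕ) := h.trans_le (min_le (mem_sdiff.2 ⟨hr, hrF⟩))
  obtain ⟨x, hx⟩ := WithTop.ne_top_iff_exists.1 h1.ne_top
  refine ⟨x, (mem_sdiff.1 (mem_of_min hx.symm)).1, ?_⟩
  rw [← hx] at h1
  exact (WithTop.coe_lt_coe.1 h1).le

theorem mem_ksubsets {n k : ℕ} {F : Finset ℕ} :
    F ∈ ksubsets n k ↔ F ⊆ Icc 1 n ∧ F.card = k := mem_powersetCard

theorem lex_insert_Icc {n k s x : ℕ} {F : Finset ℕ} (hF : F ∈ ksubsets n k)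
    (hk : 1 ≤ k) (hsk : s + k ≤ n + 1) (hx : x ∈ F) (hxs : x ≤ s) :
    lex F (insert s (Icc (n - k + 2) n)) := by
  rw [mem_ksubsets] at hF
  have hkn : k ≤ n := by
    rw [← hF.2]; simpa using card_le_card hF.1
  have hsI : s ∉ Icc (n - k + 2) n := by simp only [mem_Icc]; omega
  by_cases hsub : F ⊆ insert s (Icc (n - k + 2) n)
  · refine Or.inl (eq_of_subset_of_card_le hsub ?_).ge
    rw [card_insert_of_notMem hsI, Nat.card_Icc, hF.2]; omega
  obtain ⟨y, hy, hyI⟩ := not_subset.1 hsub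
  have hy1 := mem_Icc.1 (hF.1 hy)
  simp only [mem_insert, mem_Icc, not_or] at hyI
  by_cases hsF : s ∈ F
  · refine lex_of_forall_lt (y := y) (by simp [hy]; omega) fun z hz => ?_
    simp only [mem_sdiff, mem_insert, mem_Icc] at hz
    obtain ⟨rfl | hz, hz'⟩ := hz
    · exact absurd hsF hz'
    · omega
  · have hne : x ≠ s := fun h => hsF (h ▸ hx)
    refine lex_of_lt_forall hx fun z hz => ?_
    simp only [mem_insert, mem_Icc] at hz
    omega

theorem lex_Icc_one {s : ℕ} {R : Finset ℕ} (hR : ∀ x ∈ R, 1 ≤ x) (hc : R.card = s) :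
    lex (Icc 1 s) R := by
  by_cases hsub : Icc 1 s ⊆ R
  · exact Or.inl (eq_of_subset_of_card_le hsub (by simp [hc])).ge
  obtain ⟨y, hy, hyR⟩ := not_subset.1 hsub
  refine lex_of_forall_lt (mem_sdiff.2 ⟨hy, hyR⟩) fun z hz => ?_
  rw [mem_sdiff] at hz
  have := hR z hz.1
  simp only [mem_Icc] at hz hy
  omega

/-- If `𝒜` contains every `a`-set through `x`, then a set with at least `a` elements outside it
that meets all members of `𝒜` contains `x`. -/
theorem mem_of_crosses {n a x : ℕ} {𝒜 : Finset (Finset ℕ)} {B : Finset ℕ}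
    (ha : 1 ≤ a) (hx : x ∈ Icc 1 n) (h𝒜 : ∀ F ∈ ksubsets n a, x ∈ F → F ∈ 𝒜)
    (hB : B ⊆ Icc 1 n) (hBn : a + B.card ≤ n) (h : ∀ F ∈ 𝒜, (F ∩ B).Nonempty) : x ∈ B := by
  by_contra hxB
  have hsub : {x} ⊆ Icc 1 n \ B := by simpa using ⟨by simpa using hx, hxB⟩
  obtain ⟨F, hxF, hF, hc⟩ := exists_subsuperset_card_eq (n := a) hsub (by simpa using ha)
    (by rw [card_sdiff_of_subset hB, Nat.card_Icc]; omega)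
  obtain ⟨z, hz⟩ := h F (h𝒜 F (mem_ksubsets.2 ⟨hF.trans sdiff_subset, hc⟩)
    (hxF (mem_singleton_self x)))
  rw [mem_inter] at hz
  exact (mem_sdiff.1 (hF hz.1)).2 hz.2

theorem card_le_of_meets {n a s : ℕ} {𝒜 : Finset (Finset ℕ)} (h𝒜 : 𝒜 ⊆ ksubsets n a)
    (h : ∀ F ∈ 𝒜, ∃ x ∈ F, x ≤ s) : 𝒜.card ≤ n.choose a - (n - s).choose a := by
  have hsub : powersetCard a (Icc (s + 1) n) ⊆ ksubsets n a :=
    powersetCard_mono (Icc_subset_Icc (by omega) le_rfl)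
  have h1 : 𝒜 ⊆ ksubsets n a \ powersetCard a (Icc (s + 1) n) := by
    intro F hF
    refine mem_sdiff.2 ⟨h𝒜 hF, fun hF' => ?_⟩
    obtain ⟨x, hx, hxs⟩ := h F hF
    have := mem_Icc.1 ((mem_powersetCard.1 hF').1 hx)
    omega
  refine (card_le_card h1).trans (le_of_eq ?_)
  rw [card_sdiff_of_subset hsub, ksubsets, ground, card_powersetCard, card_powersetCard,
    Nat.card_Icc, Nat.card_Icc]
  congr 2
  omega

theorem card_eq_of_meets (n a s : ℕ) (hs : s ≤ n) :
    ((ksubsets n a).filter fun F => ∃ x ∈ F, x ≤ s).card =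
      n.choose a - (n - s).choose a := by
  refine le_antisymm (card_le_of_meets (filter_subset _ _) fun F hF => (mem_filter.1 hF).2) ?_
  have h1 : ksubsets n a \ powersetCard a (Icc (s + 1) n) ⊆
      (ksubsets n a).filter fun F => ∃ x ∈ F, x ≤ s := by
    intro F hF
    rw [mem_sdiff] at hF
    refine mem_filter.2 ⟨hF.1, ?_⟩
    by_contra! hcon
    refine hF.2 (mem_powersetCard.2 ⟨fun x hx => ?_, (mem_ksubsets.1 hF.1).2⟩)
    exact mem_Icc.2 ⟨hcon x hx, (mem_Icc.1 ((mem_ksubsets.1 hF.1).1 hx)).2⟩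
  refine le_trans (le_of_eq ?_) (card_le_card h1)
  have hsub : powersetCard a (Icc (s + 1) n) ⊆ ksubsets n a :=
    powersetCard_mono (Icc_subset_Icc (by omega) le_rfl)
  rw [card_sdiff_of_subset hsub, ksubsets, ground, card_powersetCard, card_powersetCard,
    Nat.card_Icc, Nat.card_Icc]
  congr 2
  omega

theorem injOn_sdiff_of_superset {S : Finset ℕ} {ℬ : Finset (Finset ℕ)}
    (h : ∀ B ∈ ℬ, S ⊆ B) : Set.InjOn (fun B => B \ S) (ℬ : Set (Finset ℕ)) := by
  intro B hB B' hB' e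
  rw [← sdiff_union_of_subset (h B hB), ← sdiff_union_of_subset (h B' hB')]
  exact congrArg (· ∪ S) e

theorem sdiff_Icc_one_mem {n k s : ℕ} {B : Finset ℕ} (hB : B ∈ ksubsets n k)
    (h : Icc 1 s ⊆ B) : B \ Icc 1 s ∈ powersetCard (k - s) (Icc (s + 1) n) := by
  rw [mem_ksubsets] at hB
  refine mem_powersetCard.2 ⟨fun x hx => ?_, ?_⟩
  · have := hB.1 (mem_sdiff.1 hx).1
    simp only [mem_sdiff, mem_Icc] at hx this ⊢
    omega
  · rw [card_sdiff_of_subset h, hB.2]; simp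

theorem card_le_of_superset {n k s : ℕ} {ℬ : Finset (Finset ℕ)} (hℬ : ℬ ⊆ ksubsets n k)
    (h : ∀ B ∈ ℬ, Icc 1 s ⊆ B) : ℬ.card ≤ (n - s).choose (k - s) := by
  have := card_le_card_of_injOn (t := powersetCard (k - s) (Icc (s + 1) n)) (fun B => B \ Icc 1 s)
    (fun B hB => sdiff_Icc_one_mem (hℬ hB) (h B hB)) (injOn_sdiff_of_superset h)
  rw [card_powersetCard, Nat.card_Icc] at this
  rwa [show n - s = n + 1 - (s + 1) by omega]

theorem card_eq_of_superset (n k s : ℕ) (hsk : s ≤ k) (hs : s ≤ n) :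
    ((ksubsets n k).filter fun B => Icc 1 s ⊆ B).card = (n - s).choose (k - s) := by
  refine le_antisymm (card_le_of_superset (filter_subset _ _) fun B hB => (mem_filter.1 hB).2) ?_
  have hdisj : ∀ C ∈ powersetCard (k - s) (Icc (s + 1) n), Disjoint C (Icc 1 s) := by
    intro C hC
    rw [disjoint_left]
    intro x hx hx'
    have := (mem_powersetCard.1 hC).1 hx
    simp only [mem_Icc] at this hx'
    omega
  have h1 := card_le_card_of_injOn (s := powersetCard (k - s) (Icc (s + 1) n))
    (t := (ksubsets n k).filter fun B => Icc 1 s ⊆ B) (fun C => C ∪ Icc 1 s) ?_ ?_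
  · rw [card_powersetCard, Nat.card_Icc] at h1
    rwa [show n - s = n + 1 - (s + 1) by omega]
  · intro C hC
    have hd := hdisj C hC
    have hC' := mem_powersetCard.1 hC
    simp only [coe_filter, Set.mem_ofPred_eq, mem_ksubsets]
    refine ⟨⟨union_subset (hC'.1.trans (Icc_subset_Icc (by omega) le_rfl))
      (Icc_subset_Icc le_rfl hs), ?_⟩, subset_union_right⟩
    rw [card_union_of_disjoint hd, hC'.2, Nat.card_Icc]
    omega
  · intro C hC C' hC' e
    rw [← union_sdiff_cancel_right (hdisj C hC), ← union_sdiff_cancel_right (hdisj C' hC')]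
    exact congrArg (· \ Icc 1 s) e

/-- The total size of the system whose first family consists of the `a`-sets meeting `[x]` and
whose other families consist of the `k i`-sets containing `[x]`. -/
def anchoredSum {ι : Type*} (n a : ℕ) (J : Finset ι) (k : ι → ℕ) (x : ℕ) : ℚ :=
  n.choose a - (n - x).choose a + ∑ i ∈ J, ((n - x).choose (k i - x) : ℚ)

theorem choose_pascal_sub {m j : ℕ} (hm : 1 ≤ m) (hj : 1 ≤ j) :
    (m.choose j : ℚ) = (m - 1).choose (j - 1) + (m - 1).choose j := by
  obtain ⟨m, rfl⟩ := Nat.exists_eq_add_of_le' hm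
  obtain ⟨j, rfl⟩ := Nat.exists_eq_add_of_le' hj
  simp only [Nat.add_sub_cancel]
  exact_mod_cast Nat.choose_succ_succ m j

theorem anchoredSum_succ {ι : Type*} {n a : ℕ} {J : Finset ι} {k : ι → ℕ} {x : ℕ}
    (ha : 1 ≤ a) (hxn : x + 1 ≤ n) (hxk : ∀ i ∈ J, x + 1 ≤ k i) :
    anchoredSum n a J k (x + 1) = anchoredSum n a J k x +
      ((n - (x + 1)).choose (a - 1) - ∑ i ∈ J, ((n - (x + 1)).choose (k i - x) : ℚ)) := by
  have h1 := choose_pascal_sub (m := n - x) (j := a) (by omega) ha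
  have h2 : ∑ i ∈ J, ((n - x).choose (k i - x) : ℚ) =
      ∑ i ∈ J, ((n - (x + 1)).choose (k i - (x + 1)) : ℚ) +
      ∑ i ∈ J, ((n - (x + 1)).choose (k i - x) : ℚ) := by
    rw [← sum_add_distrib]
    refine sum_congr rfl fun i hi => ?_
    have := hxk i hi
    exact choose_pascal_sub (by omega) (by omega)
  rw [Nat.sub_sub] at h1
  unfold anchoredSum
  linarith

/-- The increments of `anchoredSum` change sign at most once, from negative to positive. -/
theorem increment_nonneg_succ {ι : Type*} {n a : ℕ} {J : Finset ι} {k : ι → ℕ} {x : ℕ}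
    (ha : 1 ≤ a) (hk : ∀ i ∈ J, a + k i ≤ n) (hxn : x + 2 ≤ n) (hxk : ∀ i ∈ J, x + 2 ≤ k i)
    (hxa : x + 1 + a ≤ n)
    (h : (0 : ℚ) ≤ (n - (x + 1)).choose (a - 1) - ∑ i ∈ J, ((n - (x + 1)).choose (k i - x) : ℚ)) :
    (0 : ℚ) ≤ (n - (x + 2)).choose (a - 1) -
      ∑ i ∈ J, ((n - (x + 2)).choose (k i - (x + 1)) : ℚ) := by
  obtain ⟨m, rfl⟩ : ∃ m, n = m + x + 2 := ⟨n - (x + 2), by omega⟩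
  rw [show m + x + 2 - (x + 1) = m + 1 by omega] at h
  rw [show m + x + 2 - (x + 2) = m by omega]
  have e1 : ((m : ℚ) + 1) * m.choose (a - 1) = (m + 2 - a) * (m + 1).choose (a - 1) := by
    have h1 := Nat.choose_mul_succ_eq m (a - 1)
    rw [show m + 1 - (a - 1) = m + 2 - a by omega] at h1
    have h2 : (((m + 2 - a : ℕ)) : ℚ) = m + 2 - a := by
      rw [Nat.cast_sub (by omega)]; push_cast; ring
    rw [← h2]
    have h3 : (m.choose (a - 1) * (m + 1) : ℚ) = (m + 1).choose (a - 1) * (m + 2 - a : ℕ) := by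
      exact_mod_cast h1
    linarith
  have e2 : ∀ i ∈ J, ((m : ℚ) + 1) * m.choose (k i - (x + 1)) ≤
      (m + 2 - a) * (m + 1).choose (k i - x) := by
    intro i hi
    have h0 := hxk i hi
    have h0' := hk i hi
    have h1 := Nat.add_one_mul_choose_eq m (k i - (x + 1))
    rw [show k i - (x + 1) + 1 = k i - x by omega] at h1
    have h2 : ((m : ℚ) + 1) * m.choose (k i - (x + 1)) =
        (m + 1).choose (k i - x) * ((k i - x : ℕ) : ℚ) := by exact_mod_cast h1
    have h3 : ((k i - x : ℕ) : ℚ) + a ≤ m + 2 := by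
      have : k i - x + a ≤ m + 2 := by omega
      exact_mod_cast this
    rw [h2, mul_comm]
    exact mul_le_mul_of_nonneg_right (by linarith) (by positivity)
  have e3 := sum_le_sum e2
  rw [← mul_sum, ← mul_sum] at e3
  have ham : (0 : ℚ) ≤ m + 2 - a := by
    have : (a : ℚ) ≤ m + 2 := by exact_mod_cast (by omega : a ≤ m + 2)
    linarith
  have e4 := mul_nonneg ham h
  have hm : (0 : ℚ) < (m : ℚ) + 1 := by positivity
  refine nonneg_of_mul_nonneg_right (?_ : 0 ≤ ((m : ℚ) + 1) * _) hm
  rw [mul_sub] at e4 ⊢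
  linarith

theorem anchoredSum_le_max {ι : Type*} {n a s : ℕ} {J : Finset ι} {k : ι → ℕ}
    (ha : 1 ≤ a) (hk : ∀ i ∈ J, a + k i ≤ n) (hsk : ∀ i ∈ J, s ≤ k i) (hsa : s + a ≤ n)
    {x : ℕ} (hx : 1 ≤ x) (hxs : x ≤ s) :
    anchoredSum n a J k x ≤ max (anchoredSum n a J k 1) (anchoredSum n a J k s) := by
  set δ : ℕ → ℚ := fun x => (n - (x + 1)).choose (a - 1) -
    ∑ i ∈ J, ((n - (x + 1)).choose (k i - x) : ℚ) with hδ
  have hstep : ∀ y, y + 1 ≤ s → anchoredSum n a J k (y + 1) = anchoredSum n a J k y + δ y :=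
    fun y hy => anchoredSum_succ ha (by omega) fun i hi => hy.trans (hsk i hi)
  have hsign : ∀ y, y + 2 ≤ s → 0 ≤ δ y → 0 ≤ δ (y + 1) := fun y hy h =>
    increment_nonneg_succ ha hk (by omega) (fun i hi => hy.trans (hsk i hi)) (by omega) h
  by_cases hneg : ∀ y, 1 ≤ y → y < x → δ y ≤ 0
  · refine le_max_of_le_left ?_
    induction x, hx using Nat.le_induction with
    | base => exact le_rfl
    | succ y hy ih =>
      rw [hstep y hxs]
      linarith [ih (by omega) fun z hz hzy => hneg z hz (by omega), hneg y hy (by omega)]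
  · push Not at hneg
    obtain ⟨y, -, hyx, hy⟩ := hneg
    have hpos : ∀ z, y ≤ z → z + 1 ≤ s → 0 ≤ δ z := by
      intro z hz
      induction z, hz using Nat.le_induction with
      | base => exact fun _ => hy.le
      | succ z hz ih => exact fun h => hsign z h (ih (by omega))
    have hmono : ∀ z, x ≤ z → z ≤ s → anchoredSum n a J k x ≤ anchoredSum n a J k z := by
      intro z hz
      induction z, hz using Nat.le_induction with
      | base => exact fun _ => le_rfl
      | succ z hz ih =>
        intro h
        rw [hstep z h]
        linarith [ih (by omega), hpos z (by omega) h]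
    exact le_max_of_le_right (hmono s hxs le_rfl)

/-- The bound for one L-initial family `𝒜` meeting `[s]` and families `ℬ i` inside the star of `1`
that cross intersect `𝒜`. -/
theorem card_add_sum_card_le {ι : Type*} {n a s : ℕ} {J : Finset ι} {k : ι → ℕ}
    {R : Finset ℕ} {ℬ : ι → Finset (Finset ℕ)}
    (ha : 1 ≤ a) (hk : ∀ i ∈ J, a + k i ≤ n) (hsk : ∀ i ∈ J, s ≤ k i)
    (hsa : s + a ≤ n) (hR : R ∈ ksubsets n a)
    (hmeet : ∀ F ∈ Lset n R a, ∃ x ∈ F, x ≤ s)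
    (hℬ : ∀ i ∈ J, ℬ i ⊆ ksubsets n (k i)) (hstar : ∀ i ∈ J, ∀ B ∈ ℬ i, 1 ∈ B)
    (hcross : ∀ i ∈ J, CrossInt (Lset n R a) (ℬ i)) :
    ((Lset n R a).card : ℚ) + ∑ i ∈ J, ((ℬ i).card : ℚ) ≤
      max (anchoredSum n a J k 1) (anchoredSum n a J k s) := by
  set 𝒜 := Lset n R a with h𝒜
  have h𝒜sub : 𝒜 ⊆ ksubsets n a := filter_subset _ _
  have hR' := mem_ksubsets.1 hR
  have hRne : R.Nonempty := card_pos.1 (by omega)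
  obtain ⟨r, hrR, hrmin⟩ : ∃ r ∈ R, ∀ z ∈ R, r ≤ z :=
    ⟨R.min' hRne, R.min'_mem hRne, fun z hz => R.min'_le z hz⟩
  have hr1 : 1 ≤ r := (mem_Icc.1 (hR'.1 hrR)).1
  have hrs : r ≤ s := by
    obtain ⟨x, hx, hxs⟩ := hmeet R (mem_filter.2 ⟨hR, Or.inl Subset.rfl⟩)
    exact (hrmin x hx).trans hxs
  have hle : ∀ F ∈ 𝒜, ∃ x ∈ F, x ≤ r := fun F hF =>
    exists_le_of_lex (mem_filter.1 hF).2 hrR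
  have hcast : ∀ x, (((n.choose a - (n - x).choose a : ℕ)) : ℚ) =
      n.choose a - (n - x).choose a := fun x =>
    Nat.cast_sub (Nat.choose_le_choose a (Nat.sub_le n x))
  rcases hr1.eq_or_lt with rfl | hr2
  · refine le_max_of_le_left (add_le_add ?_ (sum_le_sum fun i hi => ?_))
    · rw [← hcast]
      exact_mod_cast card_le_of_meets h𝒜sub hle
    · exact_mod_cast card_le_of_superset (hℬ i hi) fun B hB => by simpa using hstar i hi B hB
  obtain ⟨x, rfl⟩ : ∃ x, r = x + 1 := ⟨r - 1, by omega⟩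
  have hcont : ∀ i ∈ J, ∀ B ∈ ℬ i, Icc 1 x ⊆ B := by
    intro i hi B hB y hy
    have hB' := mem_ksubsets.1 (hℬ i hi hB)
    rw [mem_Icc] at hy
    refine mem_of_crosses ha (mem_Icc.2 ⟨hy.1, by omega⟩) (fun F hF hyF => ?_) hB'.1
      (by rw [hB'.2]; exact hk i hi) fun F hF => hcross i hi F hF B hB
    exact mem_filter.2 ⟨hF, lex_of_lt_forall hyF fun z hz => by have := hrmin z hz; omega⟩
  set V := Icc (x + 2) n with hV
  have hVc : V.card = n - (x + 1) := by rw [hV, Nat.card_Icc]; omega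
  set 𝒜r := 𝒜.filter fun F => ∀ y ∈ F, x + 1 ≤ y with h𝒜r
  have hrmem : ∀ F ∈ 𝒜r, x + 1 ∈ F := by
    intro F hF
    rw [mem_filter] at hF
    obtain ⟨y, hy, hyr⟩ := hle F hF.1
    have := hF.2 y hy
    rwa [show x + 1 = y by omega]
  set 𝒜₀ := 𝒜r.image fun F => F.erase (x + 1) with h𝒜₀
  have h𝒜₀c : 𝒜₀.card = 𝒜r.card := by
    refine card_image_of_injOn fun F hF F' hF' e => ?_
    rw [← insert_erase (hrmem F hF), ← insert_erase (hrmem F' hF')]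
    exact congrArg (insert (x + 1)) e
  have h𝒜₀sub : 𝒜₀ ⊆ powersetCard (a - 1) V := by
    intro C hC
    obtain ⟨F, hF, rfl⟩ := mem_image.1 hC
    have hF' := mem_ksubsets.1 (h𝒜sub (mem_filter.1 hF).1)
    refine mem_powersetCard.2 ⟨fun y hy => ?_, by rw [card_erase_of_mem (hrmem F hF), hF'.2]⟩
    rw [mem_erase] at hy
    have h1 := (mem_filter.1 hF).2 y hy.2
    have h2 := mem_Icc.1 (hF'.1 hy.2)
    rw [hV, mem_Icc]
    omega
  have h𝒜card : (𝒜.card : ℚ) ≤ n.choose a - (n - x).choose a + 𝒜r.card := by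
    rw [← card_filter_add_card_filter_not (s := 𝒜) fun F => ∀ y ∈ F, x + 1 ≤ y, ← hcast]
    have : (𝒜.filter fun F => ¬ ∀ y ∈ F, x + 1 ≤ y).card ≤ n.choose a - (n - x).choose a := by
      refine card_le_of_meets ((filter_subset _ _).trans h𝒜sub) fun F hF => ?_
      have := (mem_filter.1 hF).2
      push Not at this
      obtain ⟨y, hy, hyx⟩ := this
      exact ⟨y, hy, by omega⟩
    push_cast
    have h' : (((𝒜.filter fun F => ¬ ∀ y ∈ F, x + 1 ≤ y).card : ℕ) : ℚ) ≤
      ((n.choose a - (n - x).choose a : ℕ) : ℚ) := by exact_mod_cast this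
    linarith
  set α : ℚ := ((n - (x + 1)).choose (a - 1) : ℚ) with hα
  have hαpos : 0 < α := by
    rw [hα]; exact_mod_cast Nat.choose_pos (by omega)
  set θ : ℚ := 𝒜₀.card / α with hθ
  have hθ0 : 0 ≤ θ := by positivity
  have hθ1 : θ ≤ 1 := by
    rw [hθ, div_le_one hαpos, hα, ← hVc, ← card_powersetCard]
    exact_mod_cast card_le_card h𝒜₀sub
  have hℬcard : ∀ i ∈ J, ((ℬ i).card : ℚ) ≤ (n - (x + 1)).choose (k i - (x + 1)) +
      (1 - θ) * (n - (x + 1)).choose (k i - x) := by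
    intro i hi
    have hki := hk i hi
    have hski := hsk i hi
    have h1 : ((ℬ i).filter fun B => x + 1 ∈ B).card ≤
        (n - (x + 1)).choose (k i - (x + 1)) := by
      refine card_le_of_superset ((filter_subset _ _).trans (hℬ i hi)) fun B hB y hy => ?_
      rw [mem_filter] at hB
      rw [mem_Icc] at hy
      rcases hy.2.eq_or_lt with rfl | hy'
      · exact hB.2
      · exact hcont i hi B hB.1 (mem_Icc.2 ⟨hy.1, by omega⟩)
    set ℬr := (ℬ i).filter fun B => x + 1 ∉ B with hℬr
    set ℬ₀ := ℬr.image fun B => B \ Icc 1 x with hℬ₀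
    have hℬ₀c : ℬ₀.card = ℬr.card :=
      card_image_of_injOn (injOn_sdiff_of_superset fun B hB => hcont i hi B (mem_filter.1 hB).1)
    have hℬ₀sub : ℬ₀ ⊆ powersetCard (k i - x) V := by
      intro C hC
      obtain ⟨B, hB, rfl⟩ := mem_image.1 hC
      rw [mem_filter] at hB
      have h2 := mem_powersetCard.1 (sdiff_Icc_one_mem (hℬ i hi hB.1) (hcont i hi B hB.1))
      refine mem_powersetCard.2 ⟨fun y hy => ?_, h2.2⟩
      have h3 := mem_Icc.1 (h2.1 hy)
      have h4 : y ≠ x + 1 := fun h => hB.2 (h ▸ (mem_sdiff.1 hy).1)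
      rw [hV, mem_Icc]
      omega
    have hX : CrossInt 𝒜₀ ℬ₀ := by
      intro C hC D hD
      obtain ⟨F, hF, rfl⟩ := mem_image.1 hC
      obtain ⟨B, hB, rfl⟩ := mem_image.1 hD
      rw [mem_filter] at hF hB
      obtain ⟨z, hz⟩ := hcross i hi F hF.1 B hB.1
      rw [mem_inter] at hz
      have hz1 := hF.2 z hz.1
      refine ⟨z, mem_inter.2 ⟨mem_erase.2 ⟨fun h => hB.2 (h ▸ hz.2), hz.1⟩,
        mem_sdiff.2 ⟨hz.2, ?_⟩⟩⟩
      rw [mem_Icc]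
      omega
    have h2 := crossInt_density_le_one (by rw [hVc]; omega) h𝒜₀sub hℬ₀sub hX
    rw [hVc, ← hα, ← hθ] at h2
    have hβ : (0 : ℚ) < (n - (x + 1)).choose (k i - x) := by
      exact_mod_cast Nat.choose_pos (by omega)
    have h3 : (ℬ₀.card : ℚ) / (n - (x + 1)).choose (k i - x) ≤ 1 - θ := by linarith
    rw [div_le_iff₀ hβ, hℬ₀c] at h3
    rw [← card_filter_add_card_filter_not (s := ℬ i) fun B => x + 1 ∈ B]
    push_cast
    exact add_le_add (by exact_mod_cast h1) h3
  have hsum := sum_le_sum hℬcard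
  rw [sum_add_distrib, ← mul_sum] at hsum
  have hθα : (𝒜r.card : ℚ) = θ * α := by
    rw [hθ, div_mul_cancel₀ _ hαpos.ne', h𝒜₀c]
  have hsucc := anchoredSum_succ (J := J) (k := k) (x := x) ha (show x + 1 ≤ n by omega)
    fun i hi => hrs.trans (hsk i hi)
  have hx1 := anchoredSum_le_max ha hk hsk hsa (x := x) (by omega) (by omega)
  have hx2 := anchoredSum_le_max ha hk hsk hsa (x := x + 1) (by omega) (by omega)
  set M := max (anchoredSum n a J k 1) (anchoredSum n a J k s)
  have hdef : anchoredSum n a J k (x + 1) = n.choose a - (n - (x + 1)).choose a +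
    ∑ i ∈ J, ((n - (x + 1)).choose (k i - (x + 1)) : ℚ) := rfl
  have hpas := choose_pascal_sub (m := n - x) (j := a) (by omega) ha
  rw [Nat.sub_sub, ← hα] at hpas
  rw [← hα] at hsucc
  nlinarith [mul_le_mul_of_nonneg_left hx1 (sub_nonneg.2 hθ1), mul_le_mul_of_nonneg_left hx2 hθ0]

theorem sum_card_le_of_boundary {ι : Type*} {n p q s : ℕ} {J : Finset ι} {k : ι → ℕ} {j : ι}
    {P Q : Finset ℕ} {ℬ : ι → Finset (Finset ℕ)}
    (hs : 1 ≤ s) (hsp : s ≤ p) (hsq : s ≤ q) (hj : j ∈ J) (hsk : ∀ i ∈ J, s ≤ k i)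
    (hpk : ∀ i ∈ J, p + k i ≤ n) (hqk : ∀ i ∈ J, q + k i ≤ n)
    (hP : P ∈ ksubsets n p) (hQ : Q ∈ ksubsets n q)
    (hℬ : ∀ i ∈ J, ℬ i ⊆ ksubsets n (k i)) (hjmem : Icc 1 s ∈ ℬ j)
    (hPℬ : ∀ i ∈ J, CrossInt (Lset n P p) (ℬ i)) (hQℬ : ∀ i ∈ J, CrossInt (Lset n Q q) (ℬ i))
    (hbd : P = insert 1 (Icc (n - p + 2) n) ∨ P = insert s (Icc (n - p + 2) n)) :
    (Lset n P p).card + (Lset n Q q).card + ∑ i ∈ J, (ℬ i).card ≤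
      max ((n - 1).choose (p - 1) + (n - 1).choose (q - 1) + ∑ i ∈ J, (n - 1).choose (k i - 1))
        ((n.choose p - (n - s).choose p) + (n.choose q - (n - s).choose q) +
          ∑ i ∈ J, (n - s).choose (k i - s)) := by
  have hjk := hsk j hj
  have hjp := hpk j hj
  have hjq := hqk j hj
  have hmeet : ∀ {R : Finset ℕ} {a : ℕ}, CrossInt (Lset n R a) (ℬ j) →
      ∀ F ∈ Lset n R a, ∃ x ∈ F, x ≤ s := by
    intro R a hX F hF
    obtain ⟨x, hx⟩ := hX F hF _ hjmem
    rw [mem_inter, mem_Icc] at hx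
    exact ⟨x, hx.1, hx.2.2⟩
  have hforce : ∀ {y : ℕ}, 1 ≤ y → y ≤ s → P = insert y (Icc (n - p + 2) n) →
      ∀ i ∈ J, ∀ B ∈ ℬ i, Icc 1 y ⊆ B := by
    intro y hy hys hPy i hi B hB x hx
    rw [mem_Icc] at hx
    have hB' := mem_ksubsets.1 (hℬ i hi hB)
    refine mem_of_crosses (a := p) (by omega) (mem_Icc.2 ⟨hx.1, by omega⟩)
      (fun F hF hxF => ?_) hB'.1 (by rw [hB'.2]; exact hpk i hi) fun F hF => hPℬ i hi F hF B hB
    refine mem_filter.2 ⟨hF, ?_⟩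
    rw [hPy]
    exact lex_insert_Icc hF (by omega) (by omega) hxF hx.2
  have hpas : ∀ {a : ℕ}, 1 ≤ a → n.choose a - (n - 1).choose a = (n - 1).choose (a - 1) := by
    intro a ha
    obtain ⟨m, rfl⟩ := Nat.exists_eq_add_of_le' (show 1 ≤ n by omega)
    obtain ⟨b, rfl⟩ := Nat.exists_eq_add_of_le' ha
    simp [Nat.choose_succ_succ]
  have hPs := card_le_of_meets (filter_subset _ _) (hmeet (hPℬ j hj))
  rcases hbd with hbd | hbd
  · have hP1 : (Lset n P p).card ≤ (n - 1).choose (p - 1) := by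
      rw [← hpas (by omega)]
      exact card_le_of_meets (filter_subset _ _) fun F hF =>
        exists_le_of_lex (mem_filter.1 hF).2 (by simp [hbd])
    have hP2 : (n - 1).choose (p - 1) ≤ n.choose p - (n - s).choose p := by
      rw [← hpas (by omega)]
      exact Nat.sub_le_sub_left (Nat.choose_le_choose p (by omega)) _
    have h := card_add_sum_card_le (a := q) (s := s) (by omega) hqk hsk (by omega) hQ
      (hmeet (hQℬ j hj)) hℬ (fun i hi B hB => hforce le_rfl hs hbd i hi B hB (by simp)) hQℬ
    have hcast : ∀ x, anchoredSum n q J k x =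
        ((n.choose q - (n - x).choose q + ∑ i ∈ J, (n - x).choose (k i - x) : ℕ) : ℚ) := by
      intro x
      rw [Nat.cast_add, Nat.cast_sub (Nat.choose_le_choose q (Nat.sub_le n x)), Nat.cast_sum]
      rfl
    rw [hcast, hcast] at h
    have h' : (Lset n Q q).card + ∑ i ∈ J, (ℬ i).card ≤
        max (n.choose q - (n - 1).choose q + ∑ i ∈ J, (n - 1).choose (k i - 1))
          (n.choose q - (n - s).choose q + ∑ i ∈ J, (n - s).choose (k i - s)) := by
      exact_mod_cast h
    rw [hpas (by omega)] at h'
    rw [le_max_iff] at h' ⊢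
    omega
  · refine le_max_of_le_right ?_
    have hQs := card_le_of_meets (filter_subset _ _) (hmeet (hQℬ j hj))
    refine add_le_add (add_le_add hPs hQs) (sum_le_sum fun i hi => ?_)
    exact card_le_of_superset (hℬ i hi) (hforce hs le_rfl hbd i hi)

theorem sum_fin_eq {t : ℕ} {u v : Fin t} (hu : (u : ℕ) = 0) (hv : (v : ℕ) = 1) (f : Fin t → ℕ) :
    ∑ i, f i = f u + f v +
      ∑ i ∈ univ.filter (fun i : Fin t => 2 ≤ (i : ℕ)), f i := by
  rw [← sum_filter_not_add_sum_filter univ (fun i : Fin t => 2 ≤ (i : ℕ)) f]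
  congr 1
  rw [← sum_pair (f := f) (by rw [Ne, Fin.ext_iff]; omega)]
  refine sum_congr ?_ fun _ _ => rfl
  ext i
  simp only [mem_filter, mem_univ, true_and, mem_insert, mem_singleton, Fin.ext_iff]
  omega

theorem sum_stars_le {n t : ℕ} {k : Fin t → ℕ} {F : Fin t → Finset (Finset ℕ)}
    (hext : Extremal n k F) (hk : ∀ i, 1 ≤ k i) (hkn : ∀ i, k i ≤ n) :
    ∑ i, (n - 1).choose (k i - 1) ≤ ∑ i, (F i).card := by
  rcases Nat.eq_zero_or_pos t with rfl | ht
  · simp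
  have hn : 1 ≤ n := (hk ⟨0, ht⟩).trans (hkn ⟨0, ht⟩)
  have hcard := fun i => card_eq_of_superset n (k i) 1 (hk i) hn
  simp_rw [← hcard]
  refine hext.2 _ ⟨fun i => filter_subset _ _, fun i => card_pos.1 ?_, fun i j _ A hA B hB => ?_⟩
  · rw [hcard]
    exact Nat.choose_pos (Nat.sub_le_sub_right (hkn i) 1)
  · exact ⟨1, mem_inter.2 ⟨(mem_filter.1 hA).2 (by simp), (mem_filter.1 hB).2 (by simp)⟩⟩

theorem sum_anchored_le {n t s : ℕ} {u v : Fin t} {k : Fin t → ℕ} {F : Fin t → Finset (Finset ℕ)}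
    (hu : (u : ℕ) = 0) (hv : (v : ℕ) = 1) (hext : Extremal n k F)
    (hs : 1 ≤ s) (hsk : ∀ i, s ≤ k i) (hkn : ∀ i, k i ≤ n)
    (hn : n < k u + k v) :
    (n.choose (k u) - (n - s).choose (k u)) +
      (n.choose (k v) - (n - s).choose (k v)) +
      ∑ i ∈ univ.filter (fun i : Fin t => 2 ≤ (i : ℕ)), (n - s).choose (k i - s) ≤
      ∑ i, (F i).card := by
  have hsn := (hsk u).trans (hkn _)
  set G : Fin t → Finset (Finset ℕ) := fun i =>
    if 2 ≤ (i : ℕ) then (ksubsets n (k i)).filter fun B => Icc 1 s ⊆ B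
    else (ksubsets n (k i)).filter fun A => ∃ x ∈ A, x ≤ s with hG
  have hsub : ∀ i, G i ⊆ ksubsets n (k i) := by
    intro i
    simp only [hG]
    split_ifs <;> exact filter_subset _ _
  have hsup : ∀ i, ((ksubsets n (k i)).filter fun B => Icc 1 s ⊆ B) ⊆ G i := by
    intro i B hB
    simp only [hG]
    split_ifs
    · exact hB
    · rw [mem_filter] at hB ⊢
      exact ⟨hB.1, 1, hB.2 (by simp [hs]), hs⟩
  have hmeet : ∀ i, ∀ A ∈ G i, ∃ x ∈ A, x ∈ Icc 1 s := by
    intro i A hA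
    have hA' := (mem_ksubsets.1 (hsub i hA)).1
    simp only [hG] at hA
    split_ifs at hA
    · exact ⟨1, (mem_filter.1 hA).2 (by simp [hs]), by simp [hs]⟩
    · obtain ⟨x, hx, hxs⟩ := (mem_filter.1 hA).2
      exact ⟨x, hx, mem_Icc.2 ⟨(mem_Icc.1 (hA' hx)).1, hxs⟩⟩
  have hcis : IsCIS n k G := by
    refine ⟨hsub, fun i => ?_, fun i j hij A hA B hB => ?_⟩
    · refine Nonempty.mono (hsup i) (card_pos.1 ?_)
      rw [card_eq_of_superset n (k i) s (hsk i) hsn]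
      exact Nat.choose_pos (Nat.sub_le_sub_right (hkn i) s)
    · by_cases hj : 2 ≤ (j : ℕ)
      · obtain ⟨x, hx, hxs⟩ := hmeet i A hA
        simp only [hG, if_pos hj, mem_filter] at hB
        exact ⟨x, mem_inter.2 ⟨hx, hB.2 hxs⟩⟩
      · have hij' : (i : ℕ) < j := hij
        have hi : k i = k u := congrArg k (Fin.ext (show (i : ℕ) = u by omega))
        have hj : k j = k v := congrArg k (Fin.ext (show (j : ℕ) = v by omega))
        have hA' := mem_ksubsets.1 (hsub _ hA)
        have hB' := mem_ksubsets.1 (hsub _ hB)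
        rw [← card_pos]
        have h1 := card_union_add_card_inter A B
        have h2 := card_le_card (union_subset hA'.1 hB'.1)
        rw [Nat.card_Icc] at h2
        omega
  have h := hext.2 G hcis
  rw [sum_fin_eq hu hv] at h
  refine le_trans (le_of_eq ?_) h
  congr 1
  · simp [hG, hu, hv, card_eq_of_meets _ _ _ hsn]
  · refine sum_congr rfl fun i hi => ?_
    simp only [hG, if_pos (mem_filter.1 hi).2]
    exact (card_eq_of_superset n (k i) s (hsk i) hsn).symm

/-- if one of the IDs `I₁, I₂` of an extremal L-initial system is the first
or last set of its range, then the total size equals `max {λ₁, λ₂}`. -/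
theorem extremal_boundary_ID (n t : ℕ) (k : Fin t → ℕ)
    (F : Fin t → Finset (Finset ℕ)) (I : Fin t → Finset ℕ)
    (ht : 3 ≤ t)
    (hanti : ∀ i j : Fin t, i ≤ j → k j ≤ k i)
    (h12 : k ⟨1, by omega⟩ < k ⟨0, by omega⟩)
    (hkt : 2 ≤ k ⟨t - 1, by omega⟩)
    (hn1 : k ⟨0, by omega⟩ + k ⟨2, by omega⟩ ≤ n)
    (hn2 : n < k ⟨0, by omega⟩ + k ⟨1, by omega⟩)
    (hext : Extremal n k F)
    (hID : ∀ i, I i ∈ ksubsets n (k i) ∧ F i = Lset n (I i) (k i))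
    (lam1 lam2 : ℕ)
    (hlam1 : lam1 = ∑ i, Nat.choose (n - 1) (k i - 1))
    (hlam2 : lam2 =
      (Nat.choose n (k ⟨0, by omega⟩) -
        Nat.choose (n - k ⟨t - 1, by omega⟩) (k ⟨0, by omega⟩)) +
      (Nat.choose n (k ⟨1, by omega⟩) -
        Nat.choose (n - k ⟨t - 1, by omega⟩) (k ⟨1, by omega⟩)) +
      ∑ i ∈ Finset.univ.filter (fun i : Fin t => 2 ≤ (i : ℕ)),
        Nat.choose (n - k ⟨t - 1, by omega⟩) (k i - k ⟨t - 1, by omega⟩))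
    (hbd : I ⟨0, by omega⟩ = insert 1 (Finset.Icc (n - k ⟨0, by omega⟩ + 2) n) ∨
           I ⟨0, by omega⟩ = insert (k ⟨t - 1, by omega⟩)
             (Finset.Icc (n - k ⟨0, by omega⟩ + 2) n) ∨
           I ⟨1, by omega⟩ = insert 1 (Finset.Icc (n - k ⟨1, by omega⟩ + 2) n) ∨
           I ⟨1, by omega⟩ = insert (k ⟨t - 1, by omega⟩)
             (Finset.Icc (n - k ⟨1, by omega⟩ + 2) n)) :
    ∑ i, (F i).card = max lam1 lam2 := by
  set s := k ⟨t - 1, by omega⟩ with hs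
  have hsk : ∀ i, s ≤ k i := fun i => hanti i _ (by simp only [Fin.le_def]; omega)
  have hk0 : ∀ i, k i ≤ k ⟨0, by omega⟩ := fun i => hanti _ i (by simp [Fin.le_def])
  have hkn : ∀ i, k i ≤ n := fun i => (hk0 i).trans (by omega)
  refine le_antisymm ?_ (max_le ?_ ?_)
  · set J := univ.filter fun i : Fin t => 2 ≤ (i : ℕ) with hJ
    have hJk : ∀ i ∈ J, k i ≤ k ⟨2, by omega⟩ := fun i hi =>
      hanti _ i (by simpa [Fin.le_def] using (mem_filter.1 hi).2)
    have hlast : (⟨t - 1, by omega⟩ : Fin t) ∈ J :=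
      mem_filter.2 ⟨mem_univ _, by simp only; omega⟩
    have hsub : ∀ i ∈ J, F i ⊆ ksubsets n (k i) := fun i _ => hext.1.1 i
    have hfirst : Icc 1 s ∈ F ⟨t - 1, by omega⟩ := by
      obtain ⟨h1, h2⟩ := hID ⟨t - 1, by omega⟩
      rw [mem_ksubsets] at h1
      rw [h2, Lset, mem_filter, mem_ksubsets]
      exact ⟨⟨Icc_subset_Icc le_rfl (hkn _), by simp [hs]⟩,
        lex_Icc_one (fun x hx => (mem_Icc.1 (h1.1 hx)).1) h1.2⟩
    have hcr : ∀ (j : Fin t), (j : ℕ) < 2 → ∀ i ∈ J, CrossInt (Lset n (I j) (k j)) (F i) := by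
      intro j hj i hi
      rw [← (hID j).2]
      exact hext.1.2.2 j i (Fin.lt_def.2 (hj.trans_le (mem_filter.1 hi).2))
    have hcr0 := hcr ⟨0, by omega⟩ (by simp)
    have hcr1 := hcr ⟨1, by omega⟩ (by simp)
    have hn0 : ∀ i ∈ J, k ⟨0, by omega⟩ + k i ≤ n := fun i hi => by have := hJk i hi; omega
    have hn1 : ∀ i ∈ J, k ⟨1, by omega⟩ + k i ≤ n := fun i hi => by have := hJk i hi; omega
    rw [hlam1, hlam2, sum_fin_eq (u := ⟨0, by omega⟩) (v := ⟨1, by omega⟩) rfl rfl,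
      sum_fin_eq (u := ⟨0, by omega⟩) (v := ⟨1, by omega⟩) rfl rfl,
      (hID ⟨0, by omega⟩).2, (hID ⟨1, by omega⟩).2]
    rcases or_assoc.2 hbd with hbd | hbd
    · exact sum_card_le_of_boundary (by omega) (hsk _) (hsk _) hlast (fun i _ => hsk i) hn0 hn1
        (hID _).1 (hID _).1 hsub hfirst hcr0 hcr1 hbd
    · have h := sum_card_le_of_boundary (by omega) (hsk _) (hsk _) hlast (fun i _ => hsk i) hn1 hn0
        (hID _).1 (hID _).1 hsub hfirst hcr1 hcr0 hbd
      rw [add_comm (Finset.card _) (Finset.card _),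
        add_comm (Nat.choose (n - 1) (k ⟨0, by omega⟩ - 1)), add_comm (_ - _) (_ - _)]
      exact h
  · rw [hlam1]
    exact sum_stars_le hext (fun i => by have := hsk i; omega) hkn
  · rw [hlam2]
    exact sum_anchored_le rfl rfl hext (by omega) hsk hkn hn2
end
end
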